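/- For each k ≥ 1, let g_n^{(k)} denote the number of λυ-terms of size n that ψ-normalise in exactly k normal-order ψ-reduction steps. Then there exists a constant c_k > 0 such that g_n^{(k)} · 4^{−n} · n^{3/2} → c_k as n → ∞, i.e., g_n^{(k)} is asymptotically c_k · 4^n · n^{−3/2}. -/

import Mathlib

mutual
/-- λυ-terms in de Bruijn notation, with explicit closures. -/
inductive LTerm : Type
  | idx : Nat → LTerm
  | lam : LTerm → LTerm
  | app : LTerm → LTerm → LTerm
  | clos : LTerm → LSub → LTerm
  deriving DecidableEq

/-- explicit λυ-substitutions. -/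
inductive LSub : Type
  | slash : LTerm → LSub
  | lift : LSub → LSub
  | shift : LSub
  deriving DecidableEq
end

mutual
/-- natural size of a λυ-term: the number of constructors (|idx n| = n+1). -/
def LTerm.size : LTerm → Nat
  | .idx n => n + 1
  | .lam a => 1 + a.size
  | .app a b => 1 + a.size + b.size
  | .clos a s => 1 + a.size + s.size

/-- natural size of a substitution. -/
def LSub.size : LSub → Nat
  | .slash a => 1 + a.size
  | .lift s => 1 + s.size
  | .shift => 1
end

/-- a λυ-term is pure if it contains no closure; pure terms are exactly the ψ-normal forms. -/
def LTerm.IsPure : LTerm → Prop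
  | .idx _ => True
  | .lam a => a.IsPure
  | .app a b => a.IsPure ∧ b.IsPure
  | .clos _ _ => False

/-- one normal-order (leftmost-outermost) ψ-reduction step. -/
inductive NStep : LTerm → LTerm → Prop
  /-- (App) (ab)[s] → a[s](b[s]) -/
  | appS (a b : LTerm) (s : LSub) :
      NStep (.clos (.app a b) s) (.app (.clos a s) (.clos b s))
  /-- (Lambda) (λa)[s] → λ(a[⇑(s)]) -/
  | lamS (a : LTerm) (s : LSub) :
      NStep (.clos (.lam a) s) (.lam (.clos a (.lift s)))
  /-- (FVar) 0[a/] → a -/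
  | fvar (a : LTerm) : NStep (.clos (.idx 0) (.slash a)) a
  /-- (RVar) (S n)[a/] → n -/
  | rvar (n : Nat) (a : LTerm) : NStep (.clos (.idx (n+1)) (.slash a)) (.idx n)
  /-- (FVarLift) 0[⇑(s)] → 0 -/
  | fvarLift (s : LSub) : NStep (.clos (.idx 0) (.lift s)) (.idx 0)
  /-- (RVarLift) (S n)[⇑(s)] → n[s][↑] -/
  | rvarLift (n : Nat) (s : LSub) :
      NStep (.clos (.idx (n+1)) (.lift s)) (.clos (.clos (.idx n) s) .shift)
  /-- (VarShift) n[↑] → S n -/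
  | varShift (n : Nat) : NStep (.clos (.idx n) .shift) (.idx (n+1))
  /-- reduce under an abstraction -/
  | lamCong {a a' : LTerm} : NStep a a' → NStep (.lam a) (.lam a')
  /-- reduce in the left part of an application -/
  | appLeft {a a' : LTerm} (b : LTerm) : NStep a a' → NStep (.app a b) (.app a' b)
  /-- reduce in the right part of an application, provided the left part is normal -/
  | appRight {b b' : LTerm} (a : LTerm) :
      a.IsPure → NStep b b' → NStep (.app a b) (.app a b')
  /-- reduce in the body of a closure, provided the closure is not itself a ψ-redex,
      i.e. its body is again a closure -/
  | closCong {t t' : LTerm} (s : LSub) :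
      (∃ u v, t = LTerm.clos u v) → NStep t t' → NStep (.clos t s) (.clos t' s)

/-- `NormIn t k` : `t` reaches its ψ-normal form in exactly `k` normal-order
ψ-reduction steps (written t ↓_k). -/
inductive NormIn : LTerm → Nat → Prop
  | base {t : LTerm} : t.IsPure → NormIn t 0
  | step {t t' : LTerm} {k : Nat} : NStep t t' → NormIn t' k → NormIn t (k+1)

/-- the number g_n^{(k)} of λυ-terms of size n that ψ-normalise in exactly k
normal-order ψ-reduction steps. -/
noncomputable def normCount (k n : ℕ) : ℕ :=
  Nat.card {t : LTerm // t.size = n ∧ NormIn t k}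


open Filter Topology PowerSeries

lemma rpow_ratio_tendsto (i : ℕ) :
    Tendsto (fun n : ℕ => ((n + i : ℕ) : ℝ) ^ ((3 : ℝ) / 2) / (n : ℝ) ^ ((3 : ℝ) / 2)) atTop (𝓝 1) := by
  have h : Tendsto (fun n : ℕ => (((n + i : ℕ) : ℝ) / n) ^ ((3 : ℝ) / 2)) atTop (𝓝 ((1 : ℝ) ^ ((3 : ℝ) / 2))) := by
    refine Tendsto.rpow_const ?_ (Or.inl one_ne_zero)
    have h1 : Tendsto (fun n : ℕ => 1 + (i : ℝ) / n) atTop (𝓝 (1 + 0)) :=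
      tendsto_const_nhds.add (tendsto_const_div_atTop_nhds_zero_nat (i : ℝ))
    rw [add_zero] at h1
    refine h1.congr' ?_
    filter_upwards [eventually_gt_atTop 0] with n hn
    have : (n : ℝ) ≠ 0 := by positivity
    push_cast
    field_simp
  rw [Real.one_rpow] at h
  refine h.congr fun n => ?_
  rw [Real.div_rpow (by positivity) (by positivity)]

/-- Half of a convolution of two sequences of order `n ^ (-3/2)`. -/
lemma tendsto_half_convolution {a b : ℕ → ℝ} {β : ℝ} (ha : Summable a)
    (hb : Tendsto (fun n : ℕ => b n * (n : ℝ) ^ ((3 : ℝ) / 2)) atTop (𝓝 β))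
    (P : ℕ → ℕ → Prop) [∀ n i, Decidable (P n i)] (hP : ∀ n i, P n i → 2 * i ≤ n)
    (hP' : ∀ i, ∀ᶠ n in atTop, P n i) :
    Tendsto (fun n : ℕ => ∑' i, if P n i then a i * (b (n - i) * (n : ℝ) ^ ((3 : ℝ) / 2)) else 0)
      atTop (𝓝 ((∑' i, a i) * β)) := by
  obtain ⟨K, hK⟩ : ∃ K, ∀ n : ℕ, |b n * (n : ℝ) ^ ((3 : ℝ) / 2)| ≤ K := by
    obtain ⟨K, hK⟩ := hb.abs.bddAbove_range
    exact ⟨K, fun n => hK ⟨n, rfl⟩⟩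
  rw [← tsum_mul_right]
  refine tendsto_tsum_of_dominated_convergence
    (bound := fun i => |a i| * (K * 2 ^ ((3 : ℝ) / 2))) (ha.abs.mul_right _) ?_ ?_
  · intro i
    have h1 : Tendsto (fun n : ℕ => a i * (b n * ((n + i : ℕ) : ℝ) ^ ((3 : ℝ) / 2))) atTop
        (𝓝 (a i * (β * 1))) := by
      refine tendsto_const_nhds.mul ((hb.mul (rpow_ratio_tendsto i)).congr' ?_)
      filter_upwards [eventually_gt_atTop 0] with n hn
      have : (n : ℝ) ^ ((3 : ℝ) / 2) ≠ 0 := by positivity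
      field_simp
    rw [mul_one] at h1
    refine (h1.comp (tendsto_sub_atTop_nat i)).congr' ?_
    filter_upwards [hP' i] with n hn
    have := hP n i hn
    simp only [Function.comp, if_pos hn]
    rw [Nat.sub_add_cancel (by lia)]
  · refine Eventually.of_forall fun n i => ?_
    have hK0 : 0 ≤ K := (abs_nonneg _).trans (hK 0)
    split_ifs with h
    · have h2 := hP n i h
      rw [Real.norm_eq_abs, abs_mul]
      refine mul_le_mul_of_nonneg_left ?_ (abs_nonneg _)
      have h3 : (n : ℝ) ^ ((3 : ℝ) / 2) ≤ ((n - i : ℕ) : ℝ) ^ ((3 : ℝ) / 2) * 2 ^ ((3 : ℝ) / 2) := by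
        rw [← Real.mul_rpow (by positivity) (by positivity)]
        refine Real.rpow_le_rpow (by positivity) ?_ (by norm_num)
        have : n ≤ (n - i) * 2 := by lia
        exact_mod_cast this
      calc |b (n - i) * (n : ℝ) ^ ((3 : ℝ) / 2)|
          = |b (n - i)| * (n : ℝ) ^ ((3 : ℝ) / 2) := by
            rw [abs_mul, abs_of_nonneg (a := (n : ℝ) ^ _) (by positivity)]
        _ ≤ |b (n - i)| * (((n - i : ℕ) : ℝ) ^ ((3 : ℝ) / 2) * 2 ^ ((3 : ℝ) / 2)) := by gcongr
        _ = |b (n - i) * ((n - i : ℕ) : ℝ) ^ ((3 : ℝ) / 2)| * 2 ^ ((3 : ℝ) / 2) := by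
            rw [abs_mul, abs_of_nonneg (a := ((n - i : ℕ) : ℝ) ^ _) (by positivity), mul_assoc]
        _ ≤ K * 2 ^ ((3 : ℝ) / 2) := by gcongr; exact hK _
    · simp only [norm_zero]; positivity

lemma tendsto_convolution {a b : ℕ → ℝ} {α β : ℝ} (ha : Summable a) (hb : Summable b)
    (hα : Tendsto (fun n : ℕ => a n * (n : ℝ) ^ ((3 : ℝ) / 2)) atTop (𝓝 α))
    (hβ : Tendsto (fun n : ℕ => b n * (n : ℝ) ^ ((3 : ℝ) / 2)) atTop (𝓝 β)) :
    Tendsto (fun n : ℕ =>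
      (∑ p ∈ Finset.HasAntidiagonal.antidiagonal n, a p.1 * b p.2) * (n : ℝ) ^ ((3 : ℝ) / 2)) atTop
      (𝓝 ((∑' n, a n) * β + (∑' n, b n) * α)) := by
  refine ((tendsto_half_convolution ha hβ (fun n i => 2 * i ≤ n) (fun _ _ h => h)
    fun i => eventually_ge_atTop _).add (tendsto_half_convolution hb hα (fun n i => 2 * i < n)
    (fun _ _ h => h.le) fun i => eventually_gt_atTop _)).congr fun n => ?_
  have key : ∀ (P : ℕ → Prop) [DecidablePred P] (f : ℕ → ℝ), (∀ i, P i → 2 * i ≤ n) →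
      ∑' i, (if P i then f i else 0) = ∑ i ∈ Finset.range (n + 1), if P i then f i else 0 := by
    intro P _ f hP
    refine tsum_eq_sum fun i hi => if_neg fun h => ?_
    have := hP i h
    simp only [Finset.mem_range] at hi
    lia
  rw [key _ _ fun _ h => h, key _ _ fun _ h => h.le, Finset.sum_mul,
    Finset.Nat.sum_antidiagonal_eq_sum_range_succ_mk,
    ← Finset.sum_range_reflect (fun i => if 2 * i < n then _ else _), ← Finset.sum_add_distrib]
  refine Finset.sum_congr rfl fun i hi => ?_
  have hi' : i ≤ n := by simpa [Nat.lt_succ_iff] using hi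
  have e : n + 1 - 1 - i = n - i := by lia
  have e2 : n - (n - i) = i := by lia
  rw [e, e2]
  by_cases h : 2 * i ≤ n
  · rw [if_pos h, if_neg (by lia)]; ring
  · rw [if_neg h, if_pos (by lia)]; ring

/-- The power series `f` has radius of convergence at least `1/4`, value `w` at `1/4`, and
coefficients asymptotic to `α * 4 ^ n * n ^ (-3/2)`. -/
def HasDens (f : ℝ⟦X⟧) (w α : ℝ) : Prop :=
  HasSum (fun n => coeff n f / 4 ^ n) w ∧
    Tendsto (fun n : ℕ => coeff n f / 4 ^ n * (n : ℝ) ^ ((3 : ℝ) / 2)) atTop (𝓝 α)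

namespace HasDens

variable {f g : ℝ⟦X⟧} {w v α β : ℝ}

lemma add (hf : HasDens f w α) (hg : HasDens g v β) : HasDens (f + g) (w + v) (α + β) := by
  constructor
  · simpa [add_div] using hf.1.add hg.1
  · simpa [add_div, add_mul] using hf.2.add hg.2

lemma mul (hf : HasDens f w α) (hg : HasDens g v β) :
    HasDens (f * g) (w * v) (w * β + v * α) := by
  have e : ∀ n, coeff n (f * g) / 4 ^ n =
      ∑ p ∈ Finset.HasAntidiagonal.antidiagonal n, coeff p.1 f / 4 ^ p.1 * (coeff p.2 g / 4 ^ p.2) := by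
    intro n
    rw [coeff_mul, Finset.sum_div]
    refine Finset.sum_congr rfl fun p hp => ?_
    rw [← Finset.HasAntidiagonal.mem_antidiagonal.1 hp, pow_add]
    field_simp
  constructor
  · simp only [e]
    rw [← hf.1.tsum_eq, ← hg.1.tsum_eq, tsum_mul_tsum_eq_tsum_sum_antidiagonal_of_summable_norm
      hf.1.summable.norm hg.1.summable.norm]
    exact (summable_norm_sum_mul_antidiagonal_of_summable_norm
      hf.1.summable.norm hg.1.summable.norm).of_norm.hasSum
  · simp only [e]
    rw [← hf.1.tsum_eq, ← hg.1.tsum_eq]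
    exact tendsto_convolution hf.1.summable hg.1.summable hf.2 hg.2

lemma sub (hf : HasDens f w α) (hg : HasDens g v β) : HasDens (f - g) (w - v) (α - β) := by
  constructor
  · simpa [sub_div] using hf.1.sub hg.1
  · simpa [sub_div, sub_mul] using hf.2.sub hg.2

lemma of_tendsto
    (h : Tendsto (fun n : ℕ => coeff n f / 4 ^ n * (n : ℝ) ^ ((3 : ℝ) / 2)) atTop (𝓝 α)) :
    ∃ w, HasDens f w α := by
  obtain ⟨K, hK⟩ := h.abs.bddAbove_range
  have hs : Summable fun n => coeff n f / 4 ^ n := by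
    refine Summable.of_norm_bounded_eventually_nat (g := fun n : ℕ => K * (n : ℝ) ^ (-(3 : ℝ) / 2))
      ((Real.summable_nat_rpow.2 (by norm_num)).mul_left K) ?_
    filter_upwards [eventually_gt_atTop 0] with n hn
    have hn' : (0 : ℝ) < n := by exact_mod_cast hn
    have hK' : |coeff n f / 4 ^ n| * (n : ℝ) ^ ((3 : ℝ) / 2) ≤ K := by
      rw [← abs_of_nonneg (a := (n : ℝ) ^ ((3 : ℝ) / 2)) (by positivity), ← abs_mul]
      exact hK ⟨n, rfl⟩
    rw [neg_div, Real.rpow_neg hn'.le, ← div_eq_mul_inv, le_div_iff₀ (by positivity)]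
    exact hK'
  exact ⟨_, hs.hasSum, h⟩

lemma of_bounded {C : ℝ} (h : ∀ n, |coeff n f| ≤ C) : ∃ w, HasDens f w 0 := by
  refine of_tendsto ?_
  have h1 : Tendsto (fun n : ℕ => C * ((n : ℝ) ^ 2 * (1 / 4) ^ n)) atTop (𝓝 (C * 0)) :=
    tendsto_const_nhds.mul
      (tendsto_pow_const_mul_const_pow_of_lt_one 2 (by norm_num) (by norm_num))
  rw [mul_zero] at h1
  refine squeeze_zero_norm' ?_ h1
  filter_upwards [eventually_ge_atTop 1] with n hn
  have hn' : (1 : ℝ) ≤ n := by exact_mod_cast hn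
  have h2 : (n : ℝ) ^ ((3 : ℝ) / 2) ≤ (n : ℝ) ^ 2 := by
    rw [← Real.rpow_natCast]
    exact Real.rpow_le_rpow_of_exponent_le hn' (by norm_num)
  have hC : 0 ≤ C := (abs_nonneg _).trans (h 0)
  rw [norm_mul, norm_div, Real.norm_eq_abs, Real.norm_eq_abs, Real.norm_eq_abs,
    abs_of_nonneg (a := (n : ℝ) ^ _) (by positivity), abs_of_pos (a := (4 : ℝ) ^ n) (by positivity)]
  calc _ ≤ C / 4 ^ n * (n : ℝ) ^ 2 := by gcongr; exact h n
    _ = _ := by rw [one_div, inv_pow]; ring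

lemma weight_unique (hf : HasDens f w α) (hg : HasDens f v β) : w = v := hf.1.unique hg.1

protected lemma zero : HasDens 0 0 0 := by
  constructor <;> simp [hasSum_zero]

protected lemma X : HasDens X (1 / 4) 0 := by
  obtain ⟨w, hw⟩ := of_bounded (f := X) (C := 1) (fun n => by
    rw [coeff_X]; split_ifs <;> simp)
  have : HasSum (fun n => coeff n (X : ℝ⟦X⟧) / 4 ^ n) (1 / 4) := by
    convert hasSum_single 1 _ using 1
    · simp
    · intro n hn
      simp [coeff_X, hn]
  rwa [hw.1.unique this] at hw

protected lemma one : HasDens 1 1 0 := by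
  obtain ⟨w, hw⟩ := of_bounded (f := 1) (C := 1) (fun n => by
    rw [coeff_one]; split_ifs <;> simp)
  have : HasSum (fun n => coeff n (1 : ℝ⟦X⟧) / 4 ^ n) 1 := by
    convert hasSum_single 0 _ using 1
    · simp
    · intro n hn
      simp [coeff_one, hn]
  rwa [hw.1.unique this] at hw

lemma X_pow (c : ℕ) : HasDens (X ^ c) ((1 / 4) ^ c) 0 := by
  induction c with
  | zero => simpa using HasDens.one
  | succ c ih => simpa [pow_succ] using ih.mul HasDens.X

end HasDens

/-- A sequence of power series whose values at `1/4` and whose leading asymptotic constants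
tend to zero. -/
def Vanishing (f : ℕ → ℝ⟦X⟧) : Prop :=
  ∃ w α : ℕ → ℝ, (∀ d, HasDens (f d) (w d) (α d)) ∧
    Tendsto w atTop (𝓝 0) ∧ Tendsto α atTop (𝓝 0)

lemma tendsto_zero_of_linear_recurrence {u v : ℕ → ℝ} {q : ℝ} (hq : |q| < 1)
    (hv : Tendsto v atTop (𝓝 0)) (hu : ∀ d, u (d + 1) = v d + q * u d) :
    Tendsto u atTop (𝓝 0) := by
  have e : ∀ d, u d = q ^ d * u 0 + ∑ i ∈ Finset.range d, q ^ i * v (d - 1 - i) := by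
    intro d
    induction d with
    | zero => simp
    | succ d ih =>
      rw [hu, ih, Finset.sum_range_succ', mul_add, Finset.mul_sum]
      have : ∀ i, q * (q ^ i * v (d - 1 - i)) = q ^ (i + 1) * v (d + 1 - 1 - (i + 1)) := by
        intro i
        rw [show d + 1 - 1 - (i + 1) = d - 1 - i by lia, pow_succ']
        ring
      simp only [this, pow_zero, Nat.add_sub_cancel, Nat.sub_zero]
      ring
  obtain ⟨K, hK⟩ : ∃ K, ∀ n : ℕ, |v n| ≤ K := by
    obtain ⟨K, hK⟩ := hv.abs.bddAbove_range
    exact ⟨K, fun n => hK ⟨n, rfl⟩⟩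
  have hT : Tendsto (fun d => ∑' i, if i < d then q ^ i * v (d - 1 - i) else 0) atTop
      (𝓝 (∑' _ : ℕ, 0)) := by
    refine tendsto_tsum_of_dominated_convergence (bound := fun i => |q| ^ i * K)
      ((summable_geometric_of_lt_one (abs_nonneg q) hq).mul_right K) (fun i => ?_)
      (Eventually.of_forall fun d i => ?_)
    · have h1 : Tendsto (fun d => q ^ i * v (d - 1 - i)) atTop (𝓝 (q ^ i * 0)) :=
        tendsto_const_nhds.mul (hv.comp ((tendsto_sub_atTop_nat i).comp (tendsto_sub_atTop_nat 1)))
      rw [mul_zero] at h1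
      refine h1.congr' ?_
      filter_upwards [eventually_gt_atTop i] with d hd
      rw [if_pos hd]
    · have hK0 : 0 ≤ K := (abs_nonneg _).trans (hK 0)
      split_ifs
      · rw [Real.norm_eq_abs, abs_mul, abs_pow]
        gcongr
        exact hK _
      · rw [norm_zero]; positivity
  have h0 := ((tendsto_pow_atTop_nhds_zero_of_abs_lt_one hq).mul_const (u 0)).add hT
  rw [tsum_zero, zero_mul, add_zero] at h0
  refine h0.congr fun d => ?_
  rw [e d, tsum_eq_sum (s := Finset.range d) fun i hi => if_neg (by simpa using hi)]
  congr 1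
  exact Finset.sum_congr rfl fun i hi => if_pos (Finset.mem_range.1 hi)

namespace Vanishing

variable {f g : ℕ → ℝ⟦X⟧}

protected lemma zero : Vanishing fun _ => 0 :=
  ⟨fun _ => 0, fun _ => 0, fun _ => HasDens.zero, tendsto_const_nhds, tendsto_const_nhds⟩

lemma add (hf : Vanishing f) (hg : Vanishing g) : Vanishing fun d => f d + g d := by
  obtain ⟨w, α, h, hw, hα⟩ := hf
  obtain ⟨v, β, h', hv, hβ⟩ := hg
  exact ⟨_, _, fun d => (h d).add (h' d), by simpa using hw.add hv, by simpa using hα.add hβ⟩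

lemma const_mul {c : ℝ⟦X⟧} {q γ : ℝ} (hc : HasDens c q γ) (hf : Vanishing f) :
    Vanishing fun d => c * f d := by
  obtain ⟨w, α, h, hw, hα⟩ := hf
  refine ⟨_, _, fun d => hc.mul (h d), ?_, ?_⟩
  · simpa using hw.const_mul q
  · simpa using (hα.const_mul q).add (hw.mul_const γ)

lemma of_recurrence {c : ℝ⟦X⟧} {q γ w₀ α₀ : ℝ} (hc : HasDens c q γ) (hq : |q| < 1)
    (h₀ : HasDens (f 0) w₀ α₀) (hg : Vanishing g) (h : ∀ d, f (d + 1) = g d + c * f d) :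
    Vanishing f := by
  obtain ⟨v, β, h', hv, hβ⟩ := hg
  let F : ℕ → ℝ × ℝ := fun d => Nat.rec (w₀, α₀)
    (fun d p => (v d + q * p.1, β d + (q * p.2 + p.1 * γ))) d
  have hF : ∀ d, HasDens (f d) (F d).1 (F d).2 := by
    intro d
    induction d with
    | zero => exact h₀
    | succ d ih => rw [h]; exact (h' d).add (hc.mul ih)
  have hw : Tendsto (fun d => (F d).1) atTop (𝓝 0) :=
    tendsto_zero_of_linear_recurrence hq hv fun d => rfl
  refine ⟨_, _, hF, hw, ?_⟩
  refine tendsto_zero_of_linear_recurrence (v := fun d => β d + (F d).1 * γ) hq ?_ fun d => ?_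
  · simpa using hβ.add (hw.mul_const γ)
  · change β d + (q * (F d).2 + (F d).1 * γ) = _
    ring

end Vanishing

section GeneratingFunctions

variable {T U V : Type*}

/-- The generating function of the elements of `A`, counted by `sz`. -/
noncomputable def gf (sz : T → ℕ) (A : Set T) : ℝ⟦X⟧ :=
  PowerSeries.mk fun n => ((A ∩ sz ⁻¹' {n}).ncard : ℝ)

lemma coeff_gf (sz : T → ℕ) (A : Set T) (n : ℕ) :
    coeff n (gf sz A) = ((A ∩ sz ⁻¹' {n}).ncard : ℝ) := coeff_mk _ _

lemma coeff_gf_nonneg (sz : T → ℕ) (A : Set T) (n : ℕ) : 0 ≤ coeff n (gf sz A) := by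
  rw [coeff_gf]; positivity

lemma gf_empty (sz : T → ℕ) : gf sz ∅ = 0 := by
  ext n; simp [coeff_gf]

lemma coeff_gf_mono {sz : T → ℕ} (hsz : ∀ n, (sz ⁻¹' {n}).Finite) {A B : Set T} (h : A ⊆ B)
    (n : ℕ) : coeff n (gf sz A) ≤ coeff n (gf sz B) := by
  rw [coeff_gf, coeff_gf]
  exact_mod_cast Set.ncard_le_ncard (Set.inter_subset_inter_left _ h)
    ((hsz n).subset Set.inter_subset_right)

lemma coeff_gf_union_le (sz : T → ℕ) (A B : Set T) (n : ℕ) :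
    coeff n (gf sz (A ∪ B)) ≤ coeff n (gf sz A) + coeff n (gf sz B) := by
  rw [coeff_gf, coeff_gf, coeff_gf, Set.union_inter_distrib_right]
  exact_mod_cast Set.ncard_union_le _ _

lemma gf_union {sz : T → ℕ} (hsz : ∀ n, (sz ⁻¹' {n}).Finite) {A B : Set T} (h : Disjoint A B) :
    gf sz (A ∪ B) = gf sz A + gf sz B := by
  ext n
  rw [map_add, coeff_gf, coeff_gf, coeff_gf, Set.union_inter_distrib_right,
    Set.ncard_union_eq (h.mono Set.inter_subset_left Set.inter_subset_left)
      ((hsz n).subset Set.inter_subset_right) ((hsz n).subset Set.inter_subset_right)]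
  push_cast
  rfl

lemma gf_image_add {sz : T → ℕ} {sz' : U → ℕ} {f : T → U} (hf : Function.Injective f) {c : ℕ}
    (h : ∀ t, sz' (f t) = sz t + c) (A : Set T) : gf sz' (f '' A) = X ^ c * gf sz A := by
  ext n
  rw [coeff_X_pow_mul']
  split_ifs with hn
  · have : f '' A ∩ sz' ⁻¹' {n} = f '' (A ∩ sz ⁻¹' {n - c}) := by
      ext x
      simp only [Set.mem_inter_iff, Set.mem_preimage, Set.mem_singleton_iff, Set.mem_image]
      constructor
      · rintro ⟨⟨t, ht, rfl⟩, hx⟩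
        exact ⟨t, ⟨ht, by have := h t; lia⟩, rfl⟩
      · rintro ⟨t, ⟨ht, hx⟩, rfl⟩
        exact ⟨⟨t, ht, rfl⟩, by have := h t; lia⟩
    rw [coeff_gf, coeff_gf, this, Set.ncard_image_of_injective _ hf]
  · have : f '' A ∩ sz' ⁻¹' {n} = ∅ := by
      ext x
      simp only [Set.mem_inter_iff, Set.mem_preimage, Set.mem_singleton_iff,
        Set.mem_empty_iff_false, iff_false, not_and]
      rintro ⟨t, -, rfl⟩
      have := h t
      lia
    rw [coeff_gf, this]
    simp

lemma gf_image {sz : T → ℕ} {sz' : U → ℕ} {f : T → U} (hf : Function.Injective f)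
    (h : ∀ t, sz' (f t) = sz t + 1) (A : Set T) : gf sz' (f '' A) = X * gf sz A := by
  rw [gf_image_add hf h, pow_one]

lemma gf_prod {sz : T → ℕ} {sz' : U → ℕ} (hsz : ∀ n, (sz ⁻¹' {n}).Finite)
    (hsz' : ∀ n, (sz' ⁻¹' {n}).Finite) (A : Set T) (B : Set U) :
    gf (fun p : T × U => sz p.1 + sz' p.2) (A ×ˢ B) = gf sz A * gf sz' B := by
  classical
  ext n
  have hA : ∀ i, (A ∩ sz ⁻¹' {i}).Finite := fun i => (hsz i).subset Set.inter_subset_right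
  have hB : ∀ i, (B ∩ sz' ⁻¹' {i}).Finite := fun i => (hsz' i).subset Set.inter_subset_right
  let F : ℕ × ℕ → Finset (T × U) := fun q => (hA q.1).toFinset ×ˢ (hB q.2).toFinset
  have hF : (A ×ˢ B) ∩ (fun p : T × U => sz p.1 + sz' p.2) ⁻¹' {n} =
      ((Finset.HasAntidiagonal.antidiagonal n).biUnion F : Finset (T × U)) := by
    ext ⟨x, y⟩
    simp only [F, Set.mem_inter_iff, Set.mem_prod, Set.mem_preimage, Set.mem_singleton_iff,
      Finset.coe_biUnion, Set.mem_iUnion, Finset.mem_coe, Finset.mem_product,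
      Set.Finite.mem_toFinset, Finset.HasAntidiagonal.mem_antidiagonal]
    constructor
    · rintro ⟨⟨hx, hy⟩, h⟩
      exact ⟨(sz x, sz' y), h, ⟨hx, rfl⟩, hy, rfl⟩
    · rintro ⟨q, hq, ⟨hx, hx'⟩, hy, hy'⟩
      exact ⟨⟨hx, hy⟩, by rw [hx', hy', hq]⟩
  rw [coeff_gf, hF, Set.ncard_coe_finset, Finset.card_biUnion, coeff_mul]
  · push_cast
    refine Finset.sum_congr rfl fun q _ => ?_
    rw [coeff_gf, coeff_gf, Finset.card_product, ← Set.ncard_eq_toFinset_card _ (hA q.1),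
      ← Set.ncard_eq_toFinset_card _ (hB q.2)]
    push_cast
    rfl
  · intro q _ r _ hqr
    rw [Function.onFun, Finset.disjoint_left]
    rintro ⟨x, y⟩ hx hy
    simp only [F, Finset.mem_product, Set.Finite.mem_toFinset, Set.mem_inter_iff, Set.mem_preimage,
      Set.mem_singleton_iff] at hx hy
    exact hqr (Prod.ext (hx.1.2.symm.trans hy.1.2) (hx.2.2.symm.trans hy.2.2))

lemma gf_image2 {sz : T → ℕ} {sz' : U → ℕ} {sz'' : V → ℕ} (hsz : ∀ n, (sz ⁻¹' {n}).Finite)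
    (hsz' : ∀ n, (sz' ⁻¹' {n}).Finite) {f : T → U → V} (hf : Function.Injective2 f)
    (h : ∀ t u, sz'' (f t u) = sz t + sz' u + 1) (A : Set T) (B : Set U) :
    gf sz'' (Set.image2 f A B) = X * (gf sz A * gf sz' B) := by
  rw [← gf_prod hsz hsz', ← Set.image_uncurry_prod]
  exact gf_image hf.uncurry (fun p => h p.1 p.2) _

/-- Every set saturated for a map with finite range and fibres of known density has a density. -/
lemma exists_hasDens_of_saturated {sz : T → ℕ} (hsz : ∀ n, (sz ⁻¹' {n}).Finite) {g : T → U}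
    (hfin : (Set.range g).Finite) (hg : ∀ u, ∃ w α, HasDens (gf sz (g ⁻¹' {u})) w α)
    {A : Set T} (hA : ∀ t t', g t = g t' → t ∈ A → t' ∈ A) :
    ∃ w α, HasDens (gf sz A) w α := by
  classical
  have key : ∀ s : Finset U, ∃ w α, HasDens (gf sz (g ⁻¹' s)) w α := by
    intro s
    induction s using Finset.induction_on with
    | empty => exact ⟨0, 0, by simpa [gf_empty] using HasDens.zero⟩
    | insert a s ha ih =>
      obtain ⟨w, α, h⟩ := hg a
      obtain ⟨v, β, h'⟩ := ih
      refine ⟨w + v, α + β, ?_⟩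
      · rw [Finset.coe_insert, Set.insert_eq, Set.preimage_union, gf_union hsz]
        · exact h.add h'
        · exact Disjoint.preimage _ (by simpa using ha)
  have hA' : (g '' A).Finite := hfin.subset (Set.image_subset_range _ _)
  have : g ⁻¹' (hA'.toFinset : Set U) = A := by
    ext t
    simp only [Set.Finite.coe_toFinset, Set.mem_preimage, Set.mem_image]
    exact ⟨fun ⟨t', ht', e⟩ => hA _ _ e ht', fun ht => ⟨t, ht, rfl⟩⟩
  rw [← this]
  exact key _

end GeneratingFunctions

lemma tendsto_catalan :
    Tendsto (fun n : ℕ => (catalan n : ℝ) / 4 ^ n * (n : ℝ) ^ ((3 : ℝ) / 2)) atTop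
      (𝓝 (1 / √Real.pi)) := by
  have hS := Stirling.tendsto_stirlingSeq_sqrt_pi
  have hpi : √Real.pi ≠ 0 := (Real.sqrt_pos.2 Real.pi_pos).ne'
  have h2 : Tendsto (fun n : ℕ => Stirling.stirlingSeq (2 * n) / Stirling.stirlingSeq n ^ 2 *
      ((n : ℝ) / (n + 1))) atTop (𝓝 (√Real.pi / √Real.pi ^ 2 * 1)) := by
    refine Tendsto.mul (Tendsto.div (hS.comp ?_) (hS.pow 2) (pow_ne_zero _ hpi))
      (tendsto_natCast_div_add_atTop 1)
    exact tendsto_id.const_mul_atTop' (by norm_num)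
  have e : √Real.pi / √Real.pi ^ 2 * 1 = 1 / √Real.pi := by field_simp
  rw [e] at h2
  refine h2.congr' ?_
  filter_upwards [eventually_gt_atTop 0] with n hn
  have hn' : (0 : ℝ) < n := by exact_mod_cast hn
  have hc : (catalan n : ℝ) = (2 * n).factorial / (n.factorial ^ 2 * (n + 1)) := by
    have h3 : ((n : ℝ) + 1) * catalan n = n.centralBinom := by
      exact_mod_cast succ_mul_catalan_eq_centralBinom n
    have h4 : (n.centralBinom : ℝ) * n.factorial * n.factorial = (2 * n).factorial := by
      have := Nat.choose_mul_factorial_mul_factorial (show n ≤ 2 * n by lia)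
      rw [show 2 * n - n = n by lia] at this
      exact_mod_cast this
    rw [← h4, ← h3]
    field_simp
  have hr : (n : ℝ) ^ ((3 : ℝ) / 2) = n * √n := by
    rw [show (3 : ℝ) / 2 = 1 + 1 / 2 by norm_num, Real.rpow_add hn', Real.rpow_one,
      Real.sqrt_eq_rpow]
  have hs : √(2 * ((2 * n : ℕ) : ℝ)) = 2 * √n := by
    push_cast
    rw [show (2 : ℝ) * (2 * n) = 2 ^ 2 * n by ring, Real.sqrt_mul (by positivity),
      Real.sqrt_sq (by norm_num)]
  have hs2 : √(2 * (n : ℝ)) ^ 2 = 2 * n := Real.sq_sqrt (by positivity)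
  have hs3 : √(n : ℝ) ^ 2 = n := Real.sq_sqrt (by positivity)
  have hp : (((2 * n : ℕ) : ℝ) / Real.exp 1) ^ (2 * n) = 4 ^ n * ((n / Real.exp 1) ^ n) ^ 2 := by
    push_cast
    rw [mul_div_assoc, mul_pow, pow_mul 2 2 n, mul_comm 2 n, pow_mul _ n 2]
    norm_num
  rw [Stirling.stirlingSeq, Stirling.stirlingSeq, hc, hr, hs, hp]
  have he : ((n : ℝ) / Real.exp 1) ^ n ≠ 0 := by positivity
  have hsn : √(n : ℝ) ≠ 0 := by positivity
  generalize ((n : ℝ) / Real.exp 1) ^ n = E at he ⊢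
  rw [div_pow, mul_pow, hs2]
  field_simp
  rw [hs3]

mutual

/-- Replace everything below depth `d` by a default. -/
def LTerm.trunc : ℕ → LTerm → LTerm
  | 0, _ => .idx 0
  | d + 1, .idx n => .idx (min n d)
  | d + 1, .lam a => .lam (a.trunc d)
  | d + 1, .app a b => .app (a.trunc d) (b.trunc d)
  | d + 1, .clos a s => .clos (a.trunc d) (s.trunc d)

/-- Replace everything below depth `d` by a default. -/
def LSub.trunc : ℕ → LSub → LSub
  | 0, _ => .shift
  | d + 1, .slash a => .slash (a.trunc d)
  | d + 1, .lift s => .lift (s.trunc d)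
  | _ + 1, .shift => .shift

end

mutual

/-- The height of a term, not counting what lies below more than `m` nested slashes. -/
def LTerm.height : ℕ → LTerm → ℕ
  | _, .idx n => n + 1
  | m, .lam a => a.height m + 1
  | m, .app a b => max (a.height m) (b.height m) + 1
  | m, .clos a s => max (a.height m) (s.height m) + 1

/-- The height of a substitution, not counting what lies below more than `m` nested slashes. -/
def LSub.height : ℕ → LSub → ℕ
  | 0, .slash _ => 0
  | m + 1, .slash a => a.height m + 1
  | m, .lift s => s.height m + 1
  | _, .shift => 0

end

mutual

/-- Two terms agree up to what lies below more than `m` nested slashes. -/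
inductive LTerm.Agree : ℕ → LTerm → LTerm → Prop
  | idx (m n : ℕ) : LTerm.Agree m (.idx n) (.idx n)
  | lam {m : ℕ} {a a' : LTerm} : LTerm.Agree m a a' → LTerm.Agree m (.lam a) (.lam a')
  | app {m : ℕ} {a a' b b' : LTerm} : LTerm.Agree m a a' → LTerm.Agree m b b' →
      LTerm.Agree m (.app a b) (.app a' b')
  | clos {m : ℕ} {a a' : LTerm} {s s' : LSub} : LTerm.Agree m a a' → LSub.Agree m s s' →
      LTerm.Agree m (.clos a s) (.clos a' s')

/-- Two substitutions agree up to what lies below more than `m` nested slashes. -/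
inductive LSub.Agree : ℕ → LSub → LSub → Prop
  | slashZero (a a' : LTerm) : LSub.Agree 0 (.slash a) (.slash a')
  | slashSucc {m : ℕ} {a a' : LTerm} : LTerm.Agree m a a' →
      LSub.Agree (m + 1) (.slash a) (.slash a')
  | lift {m : ℕ} {s s' : LSub} : LSub.Agree m s s' → LSub.Agree m (.lift s) (.lift s')
  | shift (m : ℕ) : LSub.Agree m .shift .shift

end

mutual

lemma LTerm.Agree.mono : ∀ {m m' : ℕ} {t t' : LTerm}, LTerm.Agree m t t' → m' ≤ m →
    LTerm.Agree m' t t'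
  | _, _, _, _, .idx _ n, _ => .idx _ n
  | _, _, _, _, .lam h, hm => .lam (h.mono hm)
  | _, _, _, _, .app h h', hm => .app (h.mono hm) (h'.mono hm)
  | _, _, _, _, .clos h h', hm => .clos (h.mono hm) (h'.mono hm)

lemma LSub.Agree.mono : ∀ {m m' : ℕ} {s s' : LSub}, LSub.Agree m s s' → m' ≤ m →
    LSub.Agree m' s s'
  | _, 0, _, _, .slashZero a a', _ => .slashZero a a'
  | _, 0, _, _, .slashSucc (a := a) (a' := a') _, _ => .slashZero a a'
  | _, _ + 1, _, _, .slashSucc h, hm => .slashSucc (h.mono (Nat.le_of_succ_le_succ hm))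
  | _, _, _, _, .lift h, hm => .lift (h.mono hm)
  | _, _, _, _, .shift _, _ => .shift _

end

mutual

lemma LTerm.agree_of_trunc_eq : ∀ (t t' : LTerm) {m d : ℕ}, t.trunc d = t'.trunc d →
    t.height m < d → LTerm.Agree m t t'
  | _, _, _, 0, _, hd => absurd hd (Nat.not_lt_zero _)
  | .idx n, .idx n', m, d + 1, h, hd => by
    simp only [LTerm.trunc, LTerm.idx.injEq, LTerm.height] at h hd
    obtain rfl : n = n' := by lia
    exact .idx m n
  | .lam a, .lam a', m, d + 1, h, hd => by
    simp only [LTerm.trunc, LTerm.lam.injEq, LTerm.height] at h hd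
    exact .lam (LTerm.agree_of_trunc_eq a a' h (by lia))
  | .app a b, .app a' b', m, d + 1, h, hd => by
    simp only [LTerm.trunc, LTerm.app.injEq, LTerm.height] at h hd
    exact .app (LTerm.agree_of_trunc_eq a a' h.1 (by lia))
      (LTerm.agree_of_trunc_eq b b' h.2 (by lia))
  | .clos a s, .clos a' s', m, d + 1, h, hd => by
    simp only [LTerm.trunc, LTerm.clos.injEq, LTerm.height] at h hd
    exact .clos (LTerm.agree_of_trunc_eq a a' h.1 (by lia))
      (LSub.agree_of_trunc_eq s s' h.2 (by lia))
  | .idx _, .lam _, _, _ + 1, h, _ => by simp [LTerm.trunc] at h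
  | .idx _, .app _ _, _, _ + 1, h, _ => by simp [LTerm.trunc] at h
  | .idx _, .clos _ _, _, _ + 1, h, _ => by simp [LTerm.trunc] at h
  | .lam _, .idx _, _, _ + 1, h, _ => by simp [LTerm.trunc] at h
  | .lam _, .app _ _, _, _ + 1, h, _ => by simp [LTerm.trunc] at h
  | .lam _, .clos _ _, _, _ + 1, h, _ => by simp [LTerm.trunc] at h
  | .app _ _, .idx _, _, _ + 1, h, _ => by simp [LTerm.trunc] at h
  | .app _ _, .lam _, _, _ + 1, h, _ => by simp [LTerm.trunc] at h
  | .app _ _, .clos _ _, _, _ + 1, h, _ => by simp [LTerm.trunc] at h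
  | .clos _ _, .idx _, _, _ + 1, h, _ => by simp [LTerm.trunc] at h
  | .clos _ _, .lam _, _, _ + 1, h, _ => by simp [LTerm.trunc] at h
  | .clos _ _, .app _ _, _, _ + 1, h, _ => by simp [LTerm.trunc] at h

lemma LSub.agree_of_trunc_eq : ∀ (s s' : LSub) {m d : ℕ}, s.trunc d = s'.trunc d →
    s.height m < d → LSub.Agree m s s'
  | _, _, _, 0, _, hd => absurd hd (Nat.not_lt_zero _)
  | .slash a, .slash a', 0, _ + 1, _, _ => .slashZero a a'
  | .slash a, .slash a', m + 1, d + 1, h, hd => by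
    simp only [LSub.trunc, LSub.slash.injEq, LSub.height] at h hd
    exact .slashSucc (LTerm.agree_of_trunc_eq a a' h (by lia))
  | .lift s, .lift s', m, d + 1, h, hd => by
    simp only [LSub.trunc, LSub.lift.injEq, LSub.height] at h hd
    exact .lift (LSub.agree_of_trunc_eq s s' h (by lia))
  | .shift, .shift, m, _ + 1, _, _ => .shift m
  | .slash _, .lift _, _, _ + 1, h, _ => by simp [LSub.trunc] at h
  | .slash _, .shift, _, _ + 1, h, _ => by simp [LSub.trunc] at h
  | .lift _, .slash _, _, _ + 1, h, _ => by simp [LSub.trunc] at h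
  | .lift _, .shift, _, _ + 1, h, _ => by simp [LSub.trunc] at h
  | .shift, .slash _, _, _ + 1, h, _ => by simp [LSub.trunc] at h
  | .shift, .lift _, _, _ + 1, h, _ => by simp [LSub.trunc] at h

end

lemma LTerm.Agree.isPure : ∀ {m : ℕ} {t t' : LTerm}, LTerm.Agree m t t' → t.IsPure → t'.IsPure
  | _, _, _, .idx _ _, _ => trivial
  | _, _, _, .lam h, hp => h.isPure hp
  | _, _, _, .app h h', hp => ⟨h.isPure hp.1, h'.isPure hp.2⟩

/-- Only the rule (FVar) looks inside a slash. -/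
lemma LTerm.Agree.exists_nStep {t u : LTerm} (h : NStep t u) :
    ∀ {m : ℕ} {t' : LTerm}, LTerm.Agree (m + 1) t t' → ∃ u', NStep t' u' ∧ LTerm.Agree m u u' := by
  induction h with
  | appS a b s =>
    rintro m _ (_ | _ | _ | ⟨_ | _ | ⟨ha, hb⟩, hs⟩)
    have hm := Nat.le_succ m
    exact ⟨_, .appS _ _ _,
      .app (.clos (ha.mono hm) (hs.mono hm)) (.clos (hb.mono hm) (hs.mono hm))⟩
  | lamS a s =>
    rintro m _ (_ | _ | _ | ⟨_ | ha, hs⟩)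
    have hm := Nat.le_succ m
    exact ⟨_, .lamS _ _, .lam (.clos (ha.mono hm) (.lift (hs.mono hm)))⟩
  | fvar a =>
    rintro m _ (_ | _ | _ | ⟨h, hs⟩)
    cases h
    cases hs with
    | slashSucc ha => exact ⟨_, .fvar _, ha⟩
  | rvar n a =>
    rintro m _ (_ | _ | _ | ⟨h, hs⟩)
    cases h
    cases hs
    exact ⟨_, .rvar _ _, .idx _ _⟩
  | fvarLift s =>
    rintro m _ (_ | _ | _ | ⟨h, hs⟩)
    cases h
    cases hs
    exact ⟨_, .fvarLift _, .idx _ _⟩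
  | rvarLift n s =>
    rintro m _ (_ | _ | _ | ⟨h, hs⟩)
    cases h
    cases hs with
    | lift hs =>
      exact ⟨_, .rvarLift _ _, .clos (.clos (.idx _ _) (hs.mono (Nat.le_succ m))) (.shift _)⟩
  | varShift n =>
    rintro m _ (_ | _ | _ | ⟨h, hs⟩)
    cases h
    cases hs
    exact ⟨_, .varShift _, .idx _ _⟩
  | lamCong _ ih =>
    rintro m _ (_ | h)
    obtain ⟨u', hu, hu'⟩ := ih h
    exact ⟨_, .lamCong hu, .lam hu'⟩
  | appLeft b _ ih =>
    rintro m _ (_ | _ | ⟨h, hb⟩)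
    obtain ⟨u', hu, hu'⟩ := ih h
    exact ⟨_, .appLeft _ hu, .app hu' (hb.mono (Nat.le_succ m))⟩
  | appRight a ha _ ih =>
    rintro m _ (_ | _ | ⟨h, hb⟩)
    obtain ⟨u', hu, hu'⟩ := ih hb
    exact ⟨_, .appRight _ (h.isPure ha) hu, .app (h.mono (Nat.le_succ m)) hu'⟩
  | closCong s hc _ ih =>
    rintro m _ (_ | _ | _ | ⟨h, hs⟩)
    obtain ⟨u', hu, hu'⟩ := ih h
    obtain ⟨v, w, rfl⟩ := hc
    cases h with
    | clos hv hw => exact ⟨_, .closCong _ ⟨_, _, rfl⟩ hu, .clos hu' (hs.mono (Nat.le_succ m))⟩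

lemma NormIn.of_agree {t t' : LTerm} {k : ℕ} (h : NormIn t k) (ha : LTerm.Agree k t t') :
    NormIn t' k := by
  induction h generalizing t' with
  | base hp => exact .base (ha.isPure hp)
  | step hs _ ih =>
    obtain ⟨u', hu, hu'⟩ := ha.exists_nStep hs
    exact .step hu (ih hu')

/-- `shifts j t` is `t[↑]…[↑]` with `j` shifts. -/
def shifts : ℕ → LTerm → LTerm
  | 0, t => t
  | j + 1, t => shifts j (.clos t .shift)

lemma shifts_injective (j : ℕ) : Function.Injective (shifts j) := by
  induction j with
  | zero => exact fun _ _ h => h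
  | succ j ih => exact fun t t' h => (LTerm.clos.inj (ih h)).1

lemma size_shifts (j : ℕ) (t : LTerm) : (shifts j t).size = t.size + 2 * j := by
  induction j generalizing t with
  | zero => rfl
  | succ j ih =>
    rw [shifts, ih, LTerm.size, LSub.size]
    lia

lemma nStep_shifts (j : ℕ) {t t' : LTerm} (hc : ∃ u v, t = LTerm.clos u v) (h : NStep t t') :
    NStep (shifts j t) (shifts j t') := by
  induction j generalizing t t' with
  | zero => exact h
  | succ j ih => exact ih ⟨_, _, rfl⟩ (.closCong _ hc h)

lemma normIn_shifts_idx (j n : ℕ) : NormIn (shifts j (.idx n)) j := by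
  induction j generalizing n with
  | zero => exact .base trivial
  | succ j ih => exact .step (nStep_shifts j ⟨_, _, rfl⟩ (.varShift n)) (ih _)

lemma normIn_shifts_clos_slash (j : ℕ) (a : LTerm) :
    NormIn (shifts j (.clos (.idx 1) (.slash a))) (j + 1) :=
  .step (nStep_shifts j ⟨_, _, rfl⟩ (.rvar 0 a)) (normIn_shifts_idx j 0)

section Enumeration

lemma LTerm.size_pos : ∀ t : LTerm, 0 < t.size
  | .idx _ | .lam _ | .app _ _ | .clos _ _ => by simp only [LTerm.size]; lia

lemma LSub.size_pos : ∀ s : LSub, 0 < s.size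
  | .slash _ | .lift _ | .shift => by simp only [LSub.size]; lia

lemma finite_size_le (n : ℕ) : {t : LTerm | t.size ≤ n}.Finite ∧ {s : LSub | s.size ≤ n}.Finite := by
  induction n with
  | zero =>
    constructor
    · convert Set.finite_empty
      ext t
      simpa using t.size_pos.ne'
    · convert Set.finite_empty
      ext s
      simpa using s.size_pos.ne'
  | succ n ih =>
    obtain ⟨hT, hS⟩ := ih
    constructor
    · refine (((Set.finite_Iic n).image LTerm.idx).union ((hT.image LTerm.lam).union
        ((Set.Finite.image2 LTerm.app hT hT).union (Set.Finite.image2 LTerm.clos hT hS)))).subset ?_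
      rintro (m | a | ⟨a, b⟩ | ⟨a, s⟩) h <;> simp only [Set.mem_ofPred_eq, LTerm.size] at h
      · exact .inl ⟨m, by simpa using h, rfl⟩
      · exact .inr (.inl ⟨a, by rw [Set.mem_ofPred_eq]; lia, rfl⟩)
      · exact .inr (.inr (.inl ⟨a, by rw [Set.mem_ofPred_eq]; lia, b,
          by rw [Set.mem_ofPred_eq]; lia, rfl⟩))
      · exact .inr (.inr (.inr ⟨a, by rw [Set.mem_ofPred_eq]; lia, s,
          by rw [Set.mem_ofPred_eq]; lia, rfl⟩))
    · refine ((hT.image LSub.slash).union ((hS.image LSub.lift).union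
        (Set.finite_singleton LSub.shift))).subset ?_
      rintro (a | s | _) h <;> simp only [Set.mem_ofPred_eq, LSub.size] at h
      · exact .inl ⟨a, by rw [Set.mem_ofPred_eq]; lia, rfl⟩
      · exact .inr (.inl ⟨s, by rw [Set.mem_ofPred_eq]; lia, rfl⟩)
      · exact .inr (.inr rfl)

lemma finite_term_size (n : ℕ) : (LTerm.size ⁻¹' {n}).Finite :=
  (finite_size_le n).1.subset fun _ h => le_of_eq h

lemma finite_sub_size (n : ℕ) : (LSub.size ⁻¹' {n}).Finite :=
  (finite_size_le n).2.subset fun _ h => le_of_eq h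

lemma finite_nat_size (n : ℕ) : ((id : ℕ → ℕ) ⁻¹' {n}).Finite := Set.finite_singleton n

lemma gf_image_idx (B : Set ℕ) : gf LTerm.size (LTerm.idx '' B) = X * gf id B :=
  gf_image (fun _ _ h => LTerm.idx.inj h) (fun _ => rfl) B

lemma gf_image_lam (A : Set LTerm) : gf LTerm.size (LTerm.lam '' A) = X * gf LTerm.size A :=
  gf_image (fun _ _ h => LTerm.lam.inj h) (fun _ => by rw [LTerm.size, add_comm]) A

lemma gf_image_app (A B : Set LTerm) : gf LTerm.size (Set.image2 LTerm.app A B) =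
    X * (gf LTerm.size A * gf LTerm.size B) :=
  gf_image2 finite_term_size finite_term_size (fun _ _ _ _ h => LTerm.app.inj h)
    (fun _ _ => by rw [LTerm.size]; ring) A B

lemma gf_image_clos (A : Set LTerm) (B : Set LSub) : gf LTerm.size (Set.image2 LTerm.clos A B) =
    X * (gf LTerm.size A * gf LSub.size B) :=
  gf_image2 finite_term_size finite_sub_size (fun _ _ _ _ h => LTerm.clos.inj h)
    (fun _ _ => by rw [LTerm.size]; ring) A B

lemma gf_image_slash (A : Set LTerm) : gf LSub.size (LSub.slash '' A) = X * gf LTerm.size A :=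
  gf_image (fun _ _ h => LSub.slash.inj h) (fun _ => by rw [LSub.size, add_comm]) A

lemma gf_image_lift (A : Set LSub) : gf LSub.size (LSub.lift '' A) = X * gf LSub.size A :=
  gf_image (fun _ _ h => LSub.lift.inj h) (fun _ => by rw [LSub.size, add_comm]) A

lemma gf_shift : gf LSub.size {LSub.shift} = X := by
  ext n
  rw [coeff_gf, coeff_X]
  split_ifs with h
  · subst h
    have : ({LSub.shift} : Set LSub) ∩ LSub.size ⁻¹' {1} = {LSub.shift} := by
      ext s
      simp only [Set.mem_inter_iff, Set.mem_singleton_iff, Set.mem_preimage, and_iff_left_iff_imp]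
      rintro rfl
      rfl
    rw [this, Set.ncard_singleton, Nat.cast_one]
  · have : ({LSub.shift} : Set LSub) ∩ LSub.size ⁻¹' {n} = ∅ := by
      ext s
      simp only [Set.mem_inter_iff, Set.mem_singleton_iff, Set.mem_preimage,
        Set.mem_empty_iff_false, iff_false, not_and]
      rintro rfl h'
      exact h h'.symm
    rw [this, Set.ncard_empty, Nat.cast_zero]

lemma gf_succ_image (B : Set ℕ) : gf id (Nat.succ '' B) = X * gf id B :=
  gf_image (sz := id) (sz' := id) Nat.succ_injective (fun _ => rfl) B

/-- The generating function of the natural numbers. -/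
noncomputable def natGF : ℝ⟦X⟧ := gf id (Set.univ : Set ℕ)

/-- The generating function of all terms. -/
noncomputable def termGF : ℝ⟦X⟧ := gf LTerm.size Set.univ

/-- The generating function of all substitutions. -/
noncomputable def subGF : ℝ⟦X⟧ := gf LSub.size Set.univ

lemma natGF_eq : natGF = 1 + X * natGF := by
  ext n
  have h : ∀ m, coeff m natGF = 1 := fun m => by
    rw [natGF, coeff_gf, Set.univ_inter]
    exact_mod_cast Set.ncard_singleton m
  cases n with
  | zero => rw [h]; simp
  | succ n => rw [map_add, coeff_succ_X_mul, h, h, coeff_one, if_neg n.succ_ne_zero, zero_add]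

lemma termGF_eq : termGF =
    X * natGF + (X * termGF + (X * (termGF * termGF) + X * (termGF * subGF))) := by
  have : (Set.univ : Set LTerm) = LTerm.idx '' Set.univ ∪ (LTerm.lam '' Set.univ ∪
      (Set.image2 LTerm.app Set.univ Set.univ ∪ Set.image2 LTerm.clos Set.univ Set.univ)) := by
    ext t
    cases t <;> simp
  conv_lhs => rw [termGF, this]
  rw [gf_union finite_term_size, gf_union finite_term_size, gf_union finite_term_size,
    gf_image_idx, gf_image_lam, gf_image_app, gf_image_clos]
  · rfl
  all_goals
    rw [Set.disjoint_left]
    intro t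
    cases t <;> simp

lemma subGF_eq : subGF = X * termGF + (X * subGF + X) := by
  have : (Set.univ : Set LSub) = LSub.slash '' Set.univ ∪ (LSub.lift '' Set.univ ∪
      {LSub.shift}) := by
    ext s
    cases s <;> simp
  conv_lhs => rw [subGF, this]
  rw [gf_union finite_sub_size, gf_union finite_sub_size, gf_image_slash, gf_image_lift, gf_shift]
  · rfl
  all_goals
    rw [Set.disjoint_left]
    intro s
    cases s <;> simp

lemma one_sub_X_ne_zero : (1 - X : ℝ⟦X⟧) ≠ 0 := by
  intro h
  simpa using congrArg (coeff 0) h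

lemma one_add_termGF_eq : 1 + termGF = 1 + X * ((1 + termGF) * (1 + termGF)) := by
  linear_combination (1 - X) * termGF_eq + X * natGF_eq + X * termGF * subGF_eq

lemma subGF_eq_mul : subGF = X * ((1 + termGF) * natGF) := by
  refine mul_left_cancel₀ one_sub_X_ne_zero ?_
  linear_combination subGF_eq - X * (1 + termGF) * natGF_eq

lemma coeff_one_add_termGF (n : ℕ) : coeff n (1 + termGF) = (catalan n : ℝ) := by
  induction n using Nat.strong_induction_on with
  | _ n ih =>
    rw [one_add_termGF_eq]
    cases n with
    | zero => simp
    | succ n =>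
      rw [map_add, coeff_succ_X_mul, coeff_one, if_neg n.succ_ne_zero, zero_add, coeff_mul,
        catalan_succ']
      push_cast
      refine Finset.sum_congr rfl fun p hp => ?_
      have := Finset.HasAntidiagonal.mem_antidiagonal.1 hp
      rw [ih p.1 (by lia), ih p.2 (by lia)]

lemma hasDens_natGF : HasDens natGF (4 / 3) 0 := by
  obtain ⟨w, hw⟩ := HasDens.of_bounded (f := natGF) (C := 1) fun n => by
    rw [natGF, coeff_gf, Set.univ_inter]
    simp
  have h := HasDens.one.add (HasDens.X.mul hw)
  rw [← natGF_eq] at h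
  have := hw.weight_unique h
  obtain rfl : w = 4 / 3 := by linarith
  exact hw

lemma hasDens_one_add_termGF : HasDens (1 + termGF) 2 (1 / √Real.pi) := by
  obtain ⟨w, hw⟩ := HasDens.of_tendsto (f := 1 + termGF) (α := 1 / √Real.pi) (by
    simpa only [coeff_one_add_termGF] using tendsto_catalan)
  have h := HasDens.one.add (HasDens.X.mul (hw.mul hw))
  rw [← one_add_termGF_eq] at h
  have h' := hw.weight_unique h
  have h2 : (w - 2) ^ 2 = 0 := by linear_combination 4 * (-h')
  obtain rfl : w = 2 := by linarith [pow_eq_zero_iff two_ne_zero |>.1 h2]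
  exact hw

lemma hasDens_termGF : HasDens termGF 1 (1 / √Real.pi) := by
  have h := hasDens_one_add_termGF.sub HasDens.one
  rw [add_sub_cancel_left, sub_zero] at h
  convert h using 1
  norm_num

lemma exists_hasDens_subGF : ∃ α, HasDens subGF (2 / 3) α := by
  have h := HasDens.X.mul (hasDens_one_add_termGF.mul hasDens_natGF)
  rw [← subGF_eq_mul] at h
  have : (1 / 4 : ℝ) * (2 * (4 / 3)) = 2 / 3 := by norm_num
  rw [this] at h
  exact ⟨_, h⟩

end Enumeration

section Truncation

lemma finite_range_trunc (d : ℕ) :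
    (Set.range (LTerm.trunc d)).Finite ∧ (Set.range (LSub.trunc d)).Finite := by
  induction d with
  | zero =>
    constructor
    · refine (Set.finite_singleton (LTerm.idx 0)).subset ?_
      rintro _ ⟨t, rfl⟩
      cases t <;> simp [LTerm.trunc]
    · refine (Set.finite_singleton LSub.shift).subset ?_
      rintro _ ⟨s, rfl⟩
      cases s <;> simp [LSub.trunc]
  | succ d ih =>
    obtain ⟨hT, hS⟩ := ih
    constructor
    · refine (((Set.finite_Iic d).image LTerm.idx).union ((hT.image LTerm.lam).union
        ((Set.Finite.image2 LTerm.app hT hT).union (Set.Finite.image2 LTerm.clos hT hS)))).subset ?_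
      rintro _ ⟨m | a | ⟨a, b⟩ | ⟨a, s⟩, rfl⟩
      · exact .inl ⟨_, min_le_right m d, rfl⟩
      · exact .inr (.inl ⟨_, ⟨a, rfl⟩, rfl⟩)
      · exact .inr (.inr (.inl ⟨_, ⟨a, rfl⟩, _, ⟨b, rfl⟩, rfl⟩))
      · exact .inr (.inr (.inr ⟨_, ⟨a, rfl⟩, _, ⟨s, rfl⟩, rfl⟩))
    · refine ((hT.image LSub.slash).union ((hS.image LSub.lift).union
        (Set.finite_singleton LSub.shift))).subset ?_
      rintro _ ⟨a | s | _, rfl⟩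
      · exact .inl ⟨_, ⟨a, rfl⟩, rfl⟩
      · exact .inr (.inl ⟨_, ⟨s, rfl⟩, rfl⟩)
      · exact .inr (.inr rfl)

lemma exists_hasDens_nat (B : Set ℕ) : ∃ w, HasDens (gf id B) w 0 := by
  refine HasDens.of_bounded (C := 1) fun n => ?_
  rw [coeff_gf, Nat.abs_cast]
  exact_mod_cast (Set.ncard_le_ncard Set.inter_subset_right (finite_nat_size n)).trans
    (Set.ncard_singleton n).le

lemma exists_hasDens_fibre (d : ℕ) :
    (∀ p, ∃ w α, HasDens (gf LTerm.size (LTerm.trunc d ⁻¹' {p})) w α) ∧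
      ∀ q, ∃ w α, HasDens (gf LSub.size (LSub.trunc d ⁻¹' {q})) w α := by
  obtain ⟨σ, hσ⟩ := exists_hasDens_subGF
  induction d with
  | zero =>
    constructor
    · intro p
      by_cases hp : p = .idx 0
      · have : LTerm.trunc 0 ⁻¹' {p} = Set.univ := by
          ext t; cases t <;> simp [LTerm.trunc, hp]
        rw [this]
        exact ⟨_, _, hasDens_termGF⟩
      · have : LTerm.trunc 0 ⁻¹' {p} = ∅ := by
          ext t; cases t <;> simp [LTerm.trunc, Ne.symm hp]
        rw [this, gf_empty]
        exact ⟨_, _, .zero⟩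
    · intro q
      by_cases hq : q = .shift
      · have : LSub.trunc 0 ⁻¹' {q} = Set.univ := by
          ext s; cases s <;> simp [LSub.trunc, hq]
        rw [this]
        exact ⟨_, _, hσ⟩
      · have : LSub.trunc 0 ⁻¹' {q} = ∅ := by
          ext s; cases s <;> simp [LSub.trunc, Ne.symm hq]
        rw [this, gf_empty]
        exact ⟨_, _, .zero⟩
  | succ d ih =>
    obtain ⟨hT, hS⟩ := ih
    constructor
    · rintro (j | p | ⟨p, q⟩ | ⟨p, q⟩)
      · have : LTerm.trunc (d + 1) ⁻¹' {.idx j} = LTerm.idx '' {n | min n d = j} := by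
          ext t; cases t <;> simp [LTerm.trunc]
        obtain ⟨w, hw⟩ := exists_hasDens_nat {n | min n d = j}
        rw [this, gf_image_idx]
        exact ⟨_, _, HasDens.X.mul hw⟩
      · have : LTerm.trunc (d + 1) ⁻¹' {.lam p} = LTerm.lam '' (LTerm.trunc d ⁻¹' {p}) := by
          ext t; cases t <;> simp [LTerm.trunc]
        obtain ⟨w, α, h⟩ := hT p
        rw [this, gf_image_lam]
        exact ⟨_, _, HasDens.X.mul h⟩
      · have : LTerm.trunc (d + 1) ⁻¹' {.app p q} =
            Set.image2 LTerm.app (LTerm.trunc d ⁻¹' {p}) (LTerm.trunc d ⁻¹' {q}) := by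
          ext t; cases t <;> simp [LTerm.trunc]
        obtain ⟨w, α, h⟩ := hT p
        obtain ⟨v, β, h'⟩ := hT q
        rw [this, gf_image_app]
        exact ⟨_, _, HasDens.X.mul (h.mul h')⟩
      · have : LTerm.trunc (d + 1) ⁻¹' {.clos p q} =
            Set.image2 LTerm.clos (LTerm.trunc d ⁻¹' {p}) (LSub.trunc d ⁻¹' {q}) := by
          ext t; cases t <;> simp [LTerm.trunc]
        obtain ⟨w, α, h⟩ := hT p
        obtain ⟨v, β, h'⟩ := hS q
        rw [this, gf_image_clos]
        exact ⟨_, _, HasDens.X.mul (h.mul h')⟩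
    · rintro (p | q | _)
      · have : LSub.trunc (d + 1) ⁻¹' {.slash p} = LSub.slash '' (LTerm.trunc d ⁻¹' {p}) := by
          ext s; cases s <;> simp [LSub.trunc]
        obtain ⟨w, α, h⟩ := hT p
        rw [this, gf_image_slash]
        exact ⟨_, _, HasDens.X.mul h⟩
      · have : LSub.trunc (d + 1) ⁻¹' {.lift q} = LSub.lift '' (LSub.trunc d ⁻¹' {q}) := by
          ext s; cases s <;> simp [LSub.trunc]
        obtain ⟨w, α, h⟩ := hS q
        rw [this, gf_image_lift]
        exact ⟨_, _, HasDens.X.mul h⟩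
      · have : LSub.trunc (d + 1) ⁻¹' {.shift} = {LSub.shift} := by
          ext s; cases s <;> simp [LSub.trunc]
        rw [this, gf_shift]
        exact ⟨_, _, HasDens.X⟩

end Truncation

section Height

lemma coeff_mul_le_coeff_mul {c f g : ℝ⟦X⟧} (hc : ∀ n, 0 ≤ coeff n c)
    (h : ∀ n, coeff n f ≤ coeff n g) (n : ℕ) : coeff n (c * f) ≤ coeff n (c * g) := by
  rw [coeff_mul, coeff_mul]
  exact Finset.sum_le_sum fun p _ => mul_le_mul_of_nonneg_left (h _) (hc _)

lemma coeff_mul_nonneg {f g : ℝ⟦X⟧} (hf : ∀ n, 0 ≤ coeff n f) (hg : ∀ n, 0 ≤ coeff n g) (n : ℕ) :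
    0 ≤ coeff n (f * g) := by
  rw [coeff_mul]
  exact Finset.sum_nonneg fun p _ => mul_nonneg (hf _) (hg _)

lemma coeff_X_nonneg (n : ℕ) : 0 ≤ coeff n (X : ℝ⟦X⟧) := by
  rw [coeff_X]; split_ifs <;> simp

/-- The sequence of sets `A` is dominated by power series of vanishing density. -/
def Thin {T : Type*} (sz : T → ℕ) (A : ℕ → Set T) : Prop :=
  ∃ f, Vanishing f ∧ ∀ d n, coeff n (gf sz (A d)) ≤ coeff n (f d)

lemma Thin.of_recurrence {T : Type*} {sz : T → ℕ} {A : ℕ → Set T} {c : ℝ⟦X⟧} {g : ℕ → ℝ⟦X⟧}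
    {q γ w α : ℝ} (hc : HasDens c q γ) (hq : |q| < 1) (hc0 : ∀ n, 0 ≤ coeff n c)
    (hg : Vanishing g) (h0 : HasDens (gf sz (A 0)) w α)
    (h : ∀ d n, coeff n (gf sz (A (d + 1))) ≤ coeff n (g d + c * gf sz (A d))) : Thin sz A := by
  let f : ℕ → ℝ⟦X⟧ := fun d => Nat.rec (gf sz (A 0)) (fun d F => g d + c * F) d
  refine ⟨f, Vanishing.of_recurrence hc hq h0 hg fun d => rfl, fun d => ?_⟩
  induction d with
  | zero => exact fun n => le_rfl
  | succ d ih =>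
    intro n
    refine (h d n).trans ?_
    rw [map_add]
    change _ ≤ coeff n (g d + c * f d)
    rw [map_add]
    exact add_le_add_right (coeff_mul_le_coeff_mul hc0 ih n) _

lemma vanishing_Ici : Vanishing fun d => gf id (Set.Ici d) := by
  obtain ⟨w, hw⟩ := exists_hasDens_nat (Set.Ici 0)
  refine Vanishing.of_recurrence (g := fun _ => 0) HasDens.X (by norm_num [abs_of_pos]) hw
    Vanishing.zero fun d => ?_
  rw [zero_add, ← gf_succ_image]
  congr 1
  ext n
  cases n <;> simp

lemma thin_term_height {m : ℕ} (h : Thin LSub.size fun d => {s | d ≤ s.height m}) :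
    Thin LTerm.size fun d => {t | d ≤ t.height m} := by
  obtain ⟨f, hf, hfA⟩ := h
  obtain ⟨σ, hσ⟩ := exists_hasDens_subGF
  have hT0 : ∀ n, 0 ≤ coeff n termGF := coeff_gf_nonneg _ _
  have hS0 : ∀ n, 0 ≤ coeff n subGF := coeff_gf_nonneg _ _
  refine Thin.of_recurrence
    (c := X * (1 + ((termGF + termGF) + subGF)))
    (g := fun d => X * gf id (Set.Ici d) + X * termGF * f d)
    (HasDens.X.mul (HasDens.one.add ((hasDens_termGF.add hasDens_termGF).add hσ)))
    (by norm_num [abs_of_pos]) ?_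
    ((vanishing_Ici.const_mul HasDens.X).add (hf.const_mul (HasDens.X.mul hasDens_termGF)))
    (w := 1) (α := 1 / √Real.pi) ?_ ?_
  · refine coeff_mul_nonneg coeff_X_nonneg fun n => ?_
    simp only [map_add]
    have h1 : 0 ≤ coeff n (1 : ℝ⟦X⟧) := by rw [coeff_one]; split_ifs <;> simp
    have := hT0 n
    have := hS0 n
    positivity
  · have : {t : LTerm | 0 ≤ t.height m} = Set.univ := by ext; simp
    rw [this]
    exact hasDens_termGF
  · intro d n
    set H : Set LTerm := {t | d ≤ t.height m} with hH
    set K : Set LSub := {s | d ≤ s.height m} with hK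
    have hsub : {t : LTerm | d + 1 ≤ t.height m} ⊆
        LTerm.idx '' Set.Ici d ∪ (LTerm.lam '' H ∪ (Set.image2 LTerm.app H Set.univ ∪
          (Set.image2 LTerm.app Set.univ H ∪ (Set.image2 LTerm.clos H Set.univ ∪
            Set.image2 LTerm.clos Set.univ K)))) := by
      intro t ht
      cases t <;> simp [LTerm.height] at ht <;> simp [hH, hK, ht]
    have hK' : coeff n (X * (termGF * gf LSub.size K)) ≤ coeff n (X * termGF * f d) := by
      rw [← mul_assoc]
      exact coeff_mul_le_coeff_mul (coeff_mul_nonneg coeff_X_nonneg hT0) (hfA d) n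
    have h1 := coeff_gf_mono finite_term_size hsub n
    have h2 := coeff_gf_union_le LTerm.size (LTerm.idx '' Set.Ici d) (LTerm.lam '' H ∪
      (Set.image2 LTerm.app H Set.univ ∪ (Set.image2 LTerm.app Set.univ H ∪
        (Set.image2 LTerm.clos H Set.univ ∪ Set.image2 LTerm.clos Set.univ K)))) n
    have h3 := coeff_gf_union_le LTerm.size (LTerm.lam '' H)
      (Set.image2 LTerm.app H Set.univ ∪ (Set.image2 LTerm.app Set.univ H ∪
        (Set.image2 LTerm.clos H Set.univ ∪ Set.image2 LTerm.clos Set.univ K))) n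
    have h4 := coeff_gf_union_le LTerm.size (Set.image2 LTerm.app H Set.univ)
      (Set.image2 LTerm.app Set.univ H ∪
        (Set.image2 LTerm.clos H Set.univ ∪ Set.image2 LTerm.clos Set.univ K)) n
    have h5 := coeff_gf_union_le LTerm.size (Set.image2 LTerm.app Set.univ H)
      (Set.image2 LTerm.clos H Set.univ ∪ Set.image2 LTerm.clos Set.univ K) n
    have h6 := coeff_gf_union_le LTerm.size (Set.image2 LTerm.clos H Set.univ)
      (Set.image2 LTerm.clos Set.univ K) n
    rw [gf_image_idx] at h2
    rw [gf_image_lam] at h3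
    rw [gf_image_app] at h4 h5
    rw [gf_image_clos, gf_image_clos] at h6
    change _ ≤ _ + coeff n (X * (termGF * gf LSub.size K)) at h6
    have e : X * gf id (Set.Ici d) + X * termGF * f d +
        X * (1 + ((termGF + termGF) + subGF)) * gf LTerm.size H =
        X * gf id (Set.Ici d) + X * termGF * f d + X * gf LTerm.size H +
          X * (gf LTerm.size H * termGF) + X * (termGF * gf LTerm.size H) +
          X * (gf LTerm.size H * subGF) := by ring
    rw [e]
    simp only [map_add]
    unfold termGF subGF at *
    linarith

lemma thin_sub_height (m : ℕ) : Thin LSub.size fun d => {s | d ≤ s.height m} := by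
  obtain ⟨σ, hσ⟩ := exists_hasDens_subGF
  have h0 : ∀ m, HasDens (gf LSub.size {s | 0 ≤ s.height m}) (2 / 3) σ := by
    intro m
    have : {s : LSub | 0 ≤ s.height m} = Set.univ := by ext; simp
    rw [this]
    exact hσ
  induction m with
  | zero =>
    refine Thin.of_recurrence (g := fun _ => 0) HasDens.X (by norm_num [abs_of_pos])
      coeff_X_nonneg Vanishing.zero (h0 0) fun d n => ?_
    rw [zero_add, ← gf_image_lift]
    refine coeff_gf_mono finite_sub_size ?_ n
    intro s hs
    cases s <;> simp_all [LSub.height]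
  | succ m ih =>
    obtain ⟨f, hf, hfA⟩ := thin_term_height ih
    refine Thin.of_recurrence (g := fun d => X * f d) HasDens.X (by norm_num [abs_of_pos])
      coeff_X_nonneg (hf.const_mul HasDens.X) (h0 _) fun d n => ?_
    have hsub : {s : LSub | d + 1 ≤ s.height (m + 1)} ⊆
        LSub.slash '' {t | d ≤ t.height m} ∪ LSub.lift '' {s | d ≤ s.height (m + 1)} := by
      intro s hs
      cases s <;> simp [LSub.height] at hs <;> simp [hs]
    refine (coeff_gf_mono finite_sub_size hsub n).trans ((coeff_gf_union_le _ _ _ n).trans ?_)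
    rw [map_add, gf_image_lift, gf_image_slash]
    exact add_le_add_left (coeff_mul_le_coeff_mul coeff_X_nonneg (hfA d) n) _

end Height

lemma coeff_gf_normIn (k n : ℕ) :
    coeff n (gf LTerm.size {t | NormIn t k}) = (normCount k n : ℝ) := by
  rw [coeff_gf, normCount, ← Nat.card_coe_set_eq]
  congr 1
  exact Nat.card_congr (Equiv.subtypeEquivRight fun t => and_comm)

/-- The normalised count is approximated, up to an arbitrarily small error, by sequences
with a limit. -/
lemma exists_tendsto_normCount (k : ℕ) : ∃ c : ℝ, Tendsto
    (fun n : ℕ => (normCount k n : ℝ) / 4 ^ n * (n : ℝ) ^ ((3 : ℝ) / 2)) atTop (𝓝 c) := by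
  obtain ⟨f, ⟨w, α, hf, -, hα⟩, hfA⟩ := thin_term_height (thin_sub_height k)
  refine cauchySeq_tendsto_of_complete (Metric.cauchySeq_iff'.2 fun ε hε => ?_)
  obtain ⟨d, hd⟩ := (hα.eventually (gt_mem_nhds (show (0 : ℝ) < ε / 8 by positivity))).exists
  let A : Set LTerm := {t | ∀ t', t.trunc d = t'.trunc d → NormIn t' k}
  obtain ⟨v, a, hA⟩ := exists_hasDens_of_saturated finite_term_size (finite_range_trunc d).1
    (exists_hasDens_fibre d).1 (A := A) fun t t' h ht u hu => ht u (h.trans hu)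
  have hlow : A ⊆ {t | NormIn t k} := fun t ht => ht t rfl
  have hupp : {t | NormIn t k} ⊆ A ∪ {t | d ≤ t.height k} := by
    intro t ht
    by_cases hh : d ≤ t.height k
    · exact .inr hh
    · exact .inl fun t' h => NormIn.of_agree ht (LTerm.agree_of_trunc_eq t t' h (not_le.1 hh))
  have hb : ∀ᶠ n : ℕ in atTop,
      |(normCount k n : ℝ) / 4 ^ n * (n : ℝ) ^ ((3 : ℝ) / 2) - a| < ε / 2 := by
    filter_upwards [hA.2.eventually (Metric.ball_mem_nhds a (show 0 < ε / 8 by positivity)),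
      (hf d).2.eventually (gt_mem_nhds hd)] with n hn hn'
    rw [Real.dist_eq, abs_lt] at hn
    have h1 : coeff n (gf LTerm.size A) ≤ normCount k n := by
      rw [← coeff_gf_normIn]
      exact coeff_gf_mono finite_term_size hlow n
    have h2 : (normCount k n : ℝ) ≤ coeff n (gf LTerm.size A) + coeff n (f d) := by
      rw [← coeff_gf_normIn]
      exact (coeff_gf_mono finite_term_size hupp n).trans ((coeff_gf_union_le _ _ _ n).trans
        (add_le_add_right (hfA d n) _))
    have h1' : coeff n (gf LTerm.size A) / 4 ^ n * (n : ℝ) ^ ((3 : ℝ) / 2) ≤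
        (normCount k n : ℝ) / 4 ^ n * (n : ℝ) ^ ((3 : ℝ) / 2) := by gcongr
    have h2' : (normCount k n : ℝ) / 4 ^ n * (n : ℝ) ^ ((3 : ℝ) / 2) ≤
        (coeff n (gf LTerm.size A) + coeff n (f d)) / 4 ^ n * (n : ℝ) ^ ((3 : ℝ) / 2) := by gcongr
    rw [add_div, add_mul] at h2'
    rw [abs_lt]
    constructor <;> linarith [hn.1, hn.2]
  obtain ⟨N, hN⟩ := eventually_atTop.1 hb
  refine ⟨N, fun n hn => ?_⟩
  have h1 := abs_lt.1 (hN n hn)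
  have h2 := abs_lt.1 (hN N le_rfl)
  rw [Real.dist_eq, abs_lt]
  constructor <;> linarith [h1.1, h1.2, h2.1, h2.2]

lemma coeff_X_pow_mul_termGF_le_normCount (j n : ℕ) :
    (coeff n (X ^ (4 + 2 * j) * termGF) : ℝ) ≤ (normCount (j + 1) n : ℝ) := by
  rw [termGF, ← coeff_gf_normIn,
    ← gf_image_add (sz' := LTerm.size) (f := fun a => shifts j (.clos (.idx 1) (.slash a)))]
  · refine coeff_gf_mono finite_term_size ?_ n
    rintro _ ⟨a, -, rfl⟩
    exact normIn_shifts_clos_slash j a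
  · intro a b h
    exact LSub.slash.inj (LTerm.clos.inj (shifts_injective j h)).2
  · intro a
    rw [size_shifts, LTerm.size, LTerm.size, LSub.size]
    ring

/-- For each k ≥ 1 there is a constant c_k > 0 such that
g_n^{(k)} · 4^{−n} · n^{3/2} → c_k as n → ∞, i.e. g_n^{(k)} ~ c_k · 4^n · n^{−3/2}. -/
theorem normCount_asymptotics (k : ℕ) (hk : 1 ≤ k) :
    ∃ c : ℝ, 0 < c ∧
      Filter.Tendsto
        (fun n : ℕ => (normCount k n : ℝ) / 4 ^ n * (n : ℝ) ^ ((3 : ℝ) / 2))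
        Filter.atTop (nhds c) := by

  obtain ⟨c, hc⟩ := exists_tendsto_normCount k
  refine ⟨c, lt_of_lt_of_le ?_ (le_of_tendsto_of_tendsto'
    ((HasDens.X_pow (4 + 2 * (k - 1))).mul hasDens_termGF).2 hc fun n => ?_), hc⟩
  · have := Real.pi_pos
    positivity
  · have h := coeff_X_pow_mul_termGF_le_normCount (k - 1) n
    rw [Nat.sub_add_cancel hk] at h
    gcongr
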